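/- arXiv:2203.00333 — 2 statements merged into one kernel-verified Lean document; each statement's English description precedes it below -/
import Mathlib

section
/- Let E be a finite-dimensional real inner product space and let f : E → ℝ ∪ {+∞} be a proper, convex, lower semicontinuous function. Then the effective domain dom(f) has nonempty interior if and only if the Fenchel conjugate f* is demi-coercive, i.e. there exist x₀ ∈ E, a constant c₁ > 0 and c₂ ∈ ℝ such that f*(ξ) ≥ ⟨x₀, ξ⟩ + c₁‖ξ‖ + c₂ for all ξ ∈ E. -/
open Metric
open scoped RealInnerProductSpace

/-- For a proper, convex, lower semicontinuous `f : E → ℝ ∪ {+∞}`, the effective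
domain of `f` has nonempty interior if and only if the Fenchel conjugate `f*` is demi-coercive,
i.e. `f*(ξ) ≥ ⟨x₀, ξ⟩ + c₁‖ξ‖ + c₂` for some `x₀ ∈ E`, `c₁ > 0`, `c₂ ∈ ℝ`. -/
theorem interior_domain_nonempty_iff_conjugate_demicoercive
    {E : Type*} [NormedAddCommGroup E] [InnerProductSpace ℝ E] [FiniteDimensional ℝ E]
    (f : E → EReal)
    (hproper_top : ∃ z : E, f z < ⊤)
    (hproper_bot : ∀ z : E, f z ≠ ⊥)
    (hconv : ∀ x y : E, ∀ a b : ℝ, 0 ≤ a → 0 ≤ b → a + b = 1 →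
      f (a • x + b • y) ≤ (a : EReal) * f x + (b : EReal) * f y)
    (hlsc : LowerSemicontinuous f) :
    (interior {z : E | f z < ⊤}).Nonempty ↔
      ∃ (x₀ : E) (c₁ c₂ : ℝ), 0 < c₁ ∧ ∀ ξ : E,
        ((⟪x₀, ξ⟫ : ℝ) : EReal) + ((c₁ * ‖ξ‖ : ℝ) : EReal) + (c₂ : EReal) ≤
          ⨆ z : E, (((⟪ξ, z⟫ : ℝ) : EReal) - f z) := by
  have hg : ∀ z, f z < ⊤ → f z = (((f z).toReal : ℝ) : EReal) := fun z hz =>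
    (EReal.coe_toReal hz.ne (hproper_bot z)).symm
  have hcvx : ConvexOn ℝ {z : E | f z < ⊤} (fun z => (f z).toReal) := by
    have key : ∀ x, f x < ⊤ → ∀ y, f y < ⊤ → ∀ a b : ℝ, 0 ≤ a → 0 ≤ b → a + b = 1 →
        f (a • x + b • y) ≤ ((a * (f x).toReal + b * (f y).toReal : ℝ) : EReal) := by
      intro x hx y hy a b ha hb hab
      have h := hconv x y a b ha hb hab
      rw [hg x hx, hg y hy] at h
      exact_mod_cast h
    have key2 : ∀ x, f x < ⊤ → ∀ y, f y < ⊤ → ∀ a b : ℝ, 0 ≤ a → 0 ≤ b → a + b = 1 →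
        f (a • x + b • y) < ⊤ := fun x hx y hy a b ha hb hab =>
      (key x hx y hy a b ha hb hab).trans_lt (EReal.coe_lt_top _)
    refine ⟨fun x hx y hy a b ha hb hab => key2 x hx y hy a b ha hb hab, ?_⟩
    intro x hx y hy a b ha hb hab
    have h := key x hx y hy a b ha hb hab
    rw [hg _ (key2 x hx y hy a b ha hb hab)] at h
    simpa using EReal.coe_le_coe_iff.1 h
  constructor
  · rintro ⟨x₀, hx₀⟩
    have hD : {z : E | f z < ⊤} ∈ nhds x₀ := mem_interior_iff_mem_nhds.1 hx₀
    have hct : ContinuousAt (fun z => (f z).toReal) x₀ :=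
      hcvx.continuousOn_interior.continuousAt (isOpen_interior.mem_nhds hx₀)
    have hev : ∀ᶠ z in nhds x₀, f z < ⊤ ∧ (f z).toReal < (f x₀).toReal + 1 :=
      Filter.Eventually.and hD (hct.eventually_lt_const (by simp))
    obtain ⟨r, hr, hball⟩ := Metric.eventually_nhds_iff.1 hev
    refine ⟨x₀, r / 2, -((f x₀).toReal + 1), by positivity, fun ξ => ?_⟩
    obtain ⟨u, hu, huξ⟩ : ∃ u : E, ‖u‖ ≤ 1 ∧ ⟪ξ, u⟫ = ‖ξ‖ := by
      by_cases h0 : ξ = 0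
      · exact ⟨0, by simp, by simp [h0]⟩
      · have hn : ‖ξ‖ ≠ 0 := norm_ne_zero_iff.2 h0
        refine ⟨‖ξ‖⁻¹ • ξ, ?_, ?_⟩
        · rw [norm_smul, norm_inv, norm_norm, inv_mul_cancel₀ hn]
        · rw [real_inner_smul_right, real_inner_self_eq_norm_sq]
          field_simp
    obtain ⟨h1, h2⟩ := @hball (x₀ + (r / 2) • u) (by
      rw [dist_eq_norm, add_sub_cancel_left, norm_smul, Real.norm_of_nonneg (by positivity)]
      nlinarith)
    refine le_trans ?_ (le_iSup _ (x₀ + (r / 2) • u))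
    rw [hg _ h1]
    have : ⟪x₀, ξ⟫ + r / 2 * ‖ξ‖ + -((f x₀).toReal + 1) ≤
        ⟪ξ, x₀ + (r / 2) • u⟫ - (f (x₀ + (r / 2) • u)).toReal := by
      rw [inner_add_right, real_inner_smul_right, huξ, real_inner_comm]
      linarith
    exact_mod_cast this
  · rintro ⟨x₀, c₁, c₂, hc₁, H⟩
    obtain ⟨z₀, hz₀⟩ := hproper_top
    rw [hcvx.1.interior_nonempty_iff_affineSpan_eq_top,
      AffineSubspace.affineSpan_eq_top_iff_vectorSpan_eq_top_of_nonempty ℝ E E ⟨z₀, hz₀⟩]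
    by_contra hne
    rw [← Submodule.orthogonal_eq_bot_iff] at hne
    obtain ⟨ξ, hξ, hξ0⟩ := Submodule.exists_mem_ne_zero_of_ne_bot hne
    have hconst : ∀ z, f z < ⊤ → ⟪ξ, z⟫ = ⟪ξ, z₀⟫ := by
      intro z hz
      have h := (Submodule.mem_orthogonal' _ _).1 hξ _
        (vsub_mem_vectorSpan ℝ (s := {z : E | f z < ⊤}) hz hz₀)
      rw [vsub_eq_sub, inner_sub_right] at h
      linarith
    obtain ⟨η, c, hη⟩ : ∃ (η : E) (c : ℝ), ∀ z, f z < ⊤ → ⟪η, z⟫ - c ≤ (f z).toReal := by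
      have hclosed : IsClosed {p : E × ℝ | f p.1 ≤ (p.2 : EReal)} :=
        hlsc.isClosed_epigraph.preimage
          (f := fun p : E × ℝ => (p.1, (p.2 : EReal)))
          (continuous_fst.prodMk (continuous_coe_real_ereal.comp continuous_snd))
      have heq : {p : E × ℝ | f p.1 ≤ (p.2 : EReal)} =
          {p : E × ℝ | p.1 ∈ {z : E | f z < ⊤} ∧ (f p.1).toReal ≤ p.2} := by
        ext p
        constructor
        · intro (h : f p.1 ≤ (p.2 : EReal))
          have h' : f p.1 < ⊤ := h.trans_lt (EReal.coe_lt_top _)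
          rw [hg _ h'] at h
          exact ⟨h', EReal.coe_le_coe_iff.1 h⟩
        · rintro ⟨h', h⟩
          change f p.1 ≤ (p.2 : EReal)
          rw [hg _ h']
          exact EReal.coe_le_coe_iff.2 h
      rw [heq] at hclosed
      obtain ⟨L, u, hL1, hL2⟩ := geometric_hahn_banach_point_closed hcvx.convex_epigraph hclosed
        (x := (z₀, (f z₀).toReal - 1)) (by simp)
      have hsplit : ∀ (z : E) (t : ℝ), L (z, t) = L (z, 0) + t * L (0, 1) := by
        intro z t
        rw [← smul_eq_mul, ← map_smul, ← map_add]
        simp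
      have h3 := hL2 (z₀, (f z₀).toReal) ⟨hz₀, le_rfl⟩
      rw [hsplit] at hL1 h3
      have hs : 0 < L (0, 1) := by linarith
      haveI : CompleteSpace E := FiniteDimensional.complete ℝ E
      refine ⟨-(L (0, 1))⁻¹ •
        (InnerProductSpace.toDual ℝ E).symm (L.comp (ContinuousLinearMap.inl ℝ E ℝ)),
        -(L (0, 1))⁻¹ * u, fun z hz => ?_⟩
      have h4 := hL2 (z, (f z).toReal) ⟨hz, le_rfl⟩
      rw [hsplit] at h4
      rw [real_inner_smul_left, InnerProductSpace.toDual_symm_apply]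
      simp only [ContinuousLinearMap.comp_apply, ContinuousLinearMap.inl_apply]
      have : (L (0, 1))⁻¹ * (u - L (z, 0)) ≤ (f z).toReal := by
        rw [inv_mul_le_iff₀ hs]
        linarith
      linarith
    have hup : ∀ t : ℝ, ⟪x₀, η + t • ξ⟫ + c₁ * ‖η + t • ξ‖ + c₂ ≤ c + t * ⟪ξ, z₀⟫ := by
      intro t
      have h : (⨆ z : E, (((⟪η + t • ξ, z⟫ : ℝ) : EReal) - f z)) ≤
          ((c + t * ⟪ξ, z₀⟫ : ℝ) : EReal) := by
        refine iSup_le fun z => ?_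
        by_cases hz : f z < ⊤
        · have h1 : ⟪η + t • ξ, z⟫ - (f z).toReal ≤ c + t * ⟪ξ, z₀⟫ := by
            rw [inner_add_left, real_inner_smul_left, hconst z hz]
            linarith [hη z hz]
          rw [hg z hz]
          exact_mod_cast h1
        · rw [not_lt_top_iff.1 hz, EReal.sub_top]
          exact bot_le
      exact_mod_cast (H (η + t • ξ)).trans h
    have hn : 0 < ‖ξ‖ := norm_pos_iff.2 hξ0
    have hbound : ∀ t : ℝ, 0 ≤ t → c₁ * ‖ξ‖ * t ≤ c - c₂ - ⟪x₀, η⟫ := by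
      intro t ht
      have h1 := hup t
      have h2 := hup (-t)
      rw [inner_add_right, real_inner_smul_right] at h1 h2
      have h3 : 2 * (t * ‖ξ‖) ≤ ‖η + t • ξ‖ + ‖η + (-t) • ξ‖ := by
        have h5 : (2 * t) • ξ = (η + t • ξ) - (η + (-t) • ξ) := by module
        have h6 := norm_sub_le (η + t • ξ) (η + (-t) • ξ)
        rw [← h5, norm_smul, Real.norm_of_nonneg (by positivity)] at h6
        linarith
      have h4 := mul_le_mul_of_nonneg_left h3 hc₁.le
      linarith
    have hp : 0 < c₁ * ‖ξ‖ := mul_pos hc₁ hn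
    have h7 := hbound ((|c - c₂ - ⟪x₀, η⟫| + 1) / (c₁ * ‖ξ‖)) (by positivity)
    rw [mul_div_cancel₀ _ hp.ne'] at h7
    linarith [le_abs_self (c - c₂ - ⟪x₀, η⟫)]
end

section
/- Let E be a finite-dimensional real inner product space and let F : E → ℝ ∪ {+∞} be convex, lower semicontinuous, and proper, with F(ξ) ≥ c‖ξ‖ for all ξ ∈ E for some c > 0. Assume F is essentially smooth: the interior C of dom(F) is nonempty, F is continuously differentiable on C, and ‖∇F(x_i)‖ → +∞ whenever (x_i) ⊂ C converges to a boundary point of dom(F). Then there exists a sequence of functions F_j : E → ℝ, each infinitely differentiable, convex, and globally Lipschitz, such that: (i) F_j ≤ F_{j+1} pointwise and F_j(ξ) → F(ξ) for every ξ ∈ E (sup_j F_j = F); (ii) F_j(ξ) ≥ c‖ξ‖ − 1 for all ξ and j; (iii) the recession functions F_j^∞(ξ) = sup_{t>0} F_j(tξ)/t increase pointwise to F^∞(ξ) = sup_{t>0} F(tξ)/t; (iv) F_j → F locally uniformly on C; and (v) ∇F_j → ∇F locally uniformly on C. -/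
open Filter Topology
open scoped NNReal

section helpers

variable {E : Type*} [NormedAddCommGroup E] [InnerProductSpace ℝ E] [FiniteDimensional ℝ E]

open MeasureTheory in
/-- Mollification of a convex Lipschitz function. -/
lemma exists_smooth_convex_approx (g : E → ℝ) (hg : ConvexOn ℝ Set.univ g) (K : ℝ≥0)
    (hL : LipschitzWith K g) (η : ℝ) (hη : 0 < η) :
    ∃ h : E → ℝ, ContDiff ℝ (⊤ : ℕ∞) h ∧ ConvexOn ℝ Set.univ h ∧ LipschitzWith K h ∧
      ∀ x, |h x - g x| ≤ η := by
  let _ : MeasurableSpace E := borel E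
  have : BorelSpace E := ⟨rfl⟩
  let μ : Measure E := Measure.addHaar
  have hr : 0 < η / (K + 1) := by positivity
  let φ : ContDiffBump (0 : E) := ⟨η / (K + 1) / 2, η / (K + 1), by positivity, by linarith⟩
  have hint : ∀ x, Integrable (fun t => φ.normed μ t * g (x - t)) μ := by
    intro x
    have hc : Continuous (fun t => g (x - t)) := hL.continuous.comp (by fun_prop)
    refine Continuous.integrable_of_hasCompactSupport (φ.continuous_normed.mul hc) ?_
    exact φ.hasCompactSupport_normed.mul_right
  refine ⟨fun x => ∫ t, φ.normed μ t * g (x - t) ∂μ, ?_, ?_, ?_, ?_⟩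
  · exact φ.hasCompactSupport_normed.contDiff_convolution_left (ContinuousLinearMap.lsmul ℝ ℝ)
      φ.contDiff_normed hL.continuous.locallyIntegrable
  · refine ⟨convex_univ, ?_⟩
    intro x _ y _ a b ha hb hab
    simp only [smul_eq_mul]
    rw [← integral_const_mul, ← integral_const_mul,
      ← integral_add ((hint x).const_mul a) ((hint y).const_mul b)]
    refine integral_mono (hint _) (((hint x).const_mul a).add ((hint y).const_mul b)) ?_
    intro t
    have h1 := hg.2 (Set.mem_univ (x - t)) (Set.mem_univ (y - t)) ha hb hab
    have h2 : a • x + b • y - t = a • (x - t) + b • (y - t) := by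
      have : t = a • t + b • t := by rw [← add_smul, hab, one_smul]
      nth_rewrite 1 [this]
      module
    have h3 := φ.nonneg_normed (μ := μ) t
    simp only [smul_eq_mul] at h1
    simp only [h2]
    nlinarith [mul_le_mul_of_nonneg_left h1 h3]
  · refine LipschitzWith.of_le_add_mul K ?_
    intro x y
    have : (∫ t, φ.normed μ t * g (y - t) ∂μ) + K * dist x y
        = ∫ t, (φ.normed μ t * g (y - t) + φ.normed μ t * (K * dist x y)) ∂μ := by
      rw [integral_add (hint y) (φ.integrable_normed.mul_const _), integral_mul_const,
        φ.integral_normed, one_mul]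
    rw [this]
    refine integral_mono (hint _) ((hint y).add (φ.integrable_normed.mul_const _)) ?_
    intro t
    have h1 := hL.le_add_mul (x - t) (y - t)
    rw [dist_sub_right] at h1
    have h3 := φ.nonneg_normed (μ := μ) t
    have := mul_le_mul_of_nonneg_left h1 h3
    simp only
    linarith
  · intro x
    rw [← Real.dist_eq]
    refine φ.dist_normed_convolution_le (μ := μ) hL.continuous.aestronglyMeasurable ?_
    intro y hy
    have h1 := hL.dist_le_mul y x
    have h2 : dist y x < η / (K + 1) := hy
    rw [lt_div_iff₀ (by positivity)] at h2
    nlinarith [dist_nonneg (x := y) (y := x)]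

lemma convex_gradient_ineq (g : E → ℝ) (S : Set E) (hg : ConvexOn ℝ S g) (x y v : E)
    (hx : x ∈ S) (hy : y ∈ S) (hv : HasGradientAt g v x) :
    g x + inner ℝ v (y - x) ≤ g y := by
  have h1 := hg.comp_affineMap (AffineMap.lineMap (k := ℝ) x y)
  have h2 : HasDerivAt (g ∘ (AffineMap.lineMap (k := ℝ) x y)) (inner ℝ v (y - x)) 0 := by
    have h3 : HasDerivAt (AffineMap.lineMap (k := ℝ) x y) (y - x) (0 : ℝ) :=
      AffineMap.hasDerivAt_lineMap
    have h4 : HasFDerivAt g (InnerProductSpace.toDual ℝ E v)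
      (AffineMap.lineMap (k := ℝ) x y (0 : ℝ)) := by
      simpa using hv.hasFDerivAt
    simpa using h4.comp_hasDerivAt (0 : ℝ) h3
  have h5 := h1.le_slope_of_hasDerivAt (x := 0) (y := 1) (by simpa using hx) (by simpa using hy)
    zero_lt_one h2
  simp [slope_def_field] at h5
  linarith

lemma gradient_tendsto (G : ℕ → E → ℝ) (G' : ℕ → E → E) (f : E → ℝ) (F' : E → E) (C : Set E)
    (hCo : IsOpen C) (hf : ConvexOn ℝ C f)
    (hG : ∀ j, ConvexOn ℝ Set.univ (G j))
    (hG' : ∀ j x, HasGradientAt (G j) (G' j x) x)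
    (hF' : ∀ x ∈ C, HasGradientAt f (F' x) x) (hF'c : ContinuousOn F' C)
    (hconv : TendstoLocallyUniformlyOn G f atTop C) :
    TendstoLocallyUniformlyOn G' F' atTop C := by
  rw [Metric.tendstoLocallyUniformlyOn_iff]
  intro ε hε x hx
  have hc := (hF'c.continuousAt (hCo.mem_nhds hx))
  have hc' := hc.eventually (Metric.ball_mem_nhds (F' x) (show 0 < ε / 8 by positivity))
  obtain ⟨r, hr, hrb⟩ := Metric.eventually_nhds_iff_ball.1 (hc'.and (hCo.mem_nhds hx))
  obtain ⟨s, hs, hsr⟩ : ∃ s, 0 < s ∧ 2 * s < r := ⟨r / 3, by positivity, by linarith⟩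
  have hsub : Metric.closedBall x (2 * s) ⊆ Metric.ball x r := Metric.closedBall_subset_ball hsr
  have hu := (tendstoLocallyUniformlyOn_iff_forall_isCompact hCo).1 hconv
    (Metric.closedBall x (2 * s)) (fun y hy => (hrb y (hsub hy)).2) (isCompact_closedBall _ _)
  rw [Metric.tendstoUniformlyOn_iff] at hu
  refine ⟨Metric.closedBall x s, mem_nhdsWithin_of_mem_nhds (Metric.closedBall_mem_nhds x hs), ?_⟩
  filter_upwards [hu (s * (ε / 8)) (by positivity)] with n hn y hy
  have hyx : dist y x ≤ s := hy
  have hy2 : y ∈ Metric.closedBall x (2 * s) := Metric.closedBall_subset_closedBall (by linarith) hy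
  set v := G' n y - F' x with hv
  have key : ‖v‖ ≤ 3 * (ε / 8) := by
    by_cases hv0 : v = 0
    · rw [hv0, norm_zero]; positivity
    have hvn : 0 < ‖v‖ := norm_pos_iff.2 hv0
    set u := ‖v‖⁻¹ • v with hudef
    have hun : ‖u‖ = 1 := by
      rw [hudef, norm_smul, norm_inv, norm_norm, inv_mul_cancel₀ hvn.ne']
    have hvu : inner ℝ v u = ‖v‖ := by
      rw [hudef, inner_smul_right, real_inner_self_eq_norm_sq]
      field_simp
    set z := y + s • u with hz
    have hz2 : z ∈ Metric.closedBall x (2 * s) := by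
      rw [Metric.mem_closedBall]
      have : dist z y = s := by
        rw [hz, dist_eq_norm, add_sub_cancel_left, norm_smul, hun, Real.norm_of_nonneg hs.le,
          mul_one]
      linarith [dist_triangle z y x]
    have e1 := convex_gradient_ineq (G n) Set.univ (hG n) y z (G' n y) trivial trivial (hG' n y)
    have e2 := convex_gradient_ineq f C hf z y (F' z) (hrb z (hsub hz2)).2 (hrb y (hsub hy2)).2
      (hF' z (hrb z (hsub hz2)).2)
    have hzy : z - y = s • u := by rw [hz]; abel
    have hyz : y - z = -(s • u) := by rw [hz]; abel
    rw [hzy, inner_smul_right] at e1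
    rw [hyz, inner_neg_right, inner_smul_right] at e2
    have n1 := hn z hz2
    have n2 := hn y hy2
    rw [Real.dist_eq, abs_lt] at n1 n2
    have n3 : inner ℝ (F' z - F' x) u ≤ ε / 8 := by
      refine (real_inner_le_norm _ _).trans ?_
      rw [hun, mul_one, ← dist_eq_norm]
      exact (hrb z (hsub hz2)).1.le
    rw [inner_sub_left] at n3
    rw [hv, inner_sub_left, ← hv] at hvu
    have : s * ‖v‖ ≤ s * (3 * (ε / 8)) := by
      rw [← hvu]
      nlinarith
    exact le_of_mul_le_mul_left this hs
  have k2 : dist (F' y) (F' x) < ε / 8 := (hrb y (hsub hy2)).1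
  have k3 : dist (G' n y) (F' x) ≤ 3 * (ε / 8) := by rw [dist_eq_norm]; exact key
  have := dist_triangle_right (F' y) (G' n y) (F' x)
  linarith

/-- Pasch-Hausdorff envelope. -/
noncomputable def paschEnv (D : Set E) (f : E → ℝ) (k : ℝ) (x : E) : ℝ :=
  ⨅ y : D, (f y + k * ‖x - y‖)

lemma pasch_bdd (D : Set E) (f : E → ℝ) (hf0 : ∀ y ∈ D, 0 ≤ f y) (k : ℝ) (hk : 0 ≤ k) (x : E) :
    BddBelow (Set.range fun y : D => f y + k * ‖x - y‖) := by
  refine ⟨0, ?_⟩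
  rintro _ ⟨y, rfl⟩
  have := hf0 y y.2
  positivity

lemma pasch_le (D : Set E) (f : E → ℝ) (hf0 : ∀ y ∈ D, 0 ≤ f y) (k : ℝ) (hk : 0 ≤ k) (x y : E)
    (hy : y ∈ D) : paschEnv D f k x ≤ f y + k * ‖x - y‖ :=
  ciInf_le (pasch_bdd D f hf0 k hk x) ⟨y, hy⟩

lemma le_pasch (D : Set E) (hD : D.Nonempty) (f : E → ℝ) (k : ℝ) (x : E) (m : ℝ)
    (h : ∀ y ∈ D, m ≤ f y + k * ‖x - y‖) : m ≤ paschEnv D f k x := by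
  have := hD.to_subtype
  exact le_ciInf fun y => h y y.2

lemma pasch_lt (D : Set E) (hD : D.Nonempty) (f : E → ℝ) (k : ℝ) (x : E) (m : ℝ)
    (h : paschEnv D f k x < m) : ∃ y ∈ D, f y + k * ‖x - y‖ < m := by
  by_contra! hcon
  exact absurd (le_pasch D hD f k x m hcon) (not_le.2 h)

lemma pasch_lip (D : Set E) (hD : D.Nonempty) (f : E → ℝ) (hf0 : ∀ y ∈ D, 0 ≤ f y) (k : ℝ≥0) :
    LipschitzWith k (paschEnv D f k) := by
  refine LipschitzWith.of_le_add_mul k fun x y => ?_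
  rw [← sub_le_iff_le_add]
  refine le_pasch D hD f k y _ fun z hz => ?_
  have h1 := pasch_le D f hf0 k k.2 x z hz
  have h2 : ‖x - z‖ ≤ dist x y + ‖y - z‖ := by
    rw [← dist_eq_norm, ← dist_eq_norm]; exact dist_triangle _ _ _
  have h3 := mul_le_mul_of_nonneg_left h2 k.coe_nonneg
  linarith

lemma pasch_convex (D : Set E) (hD : D.Nonempty) (f : E → ℝ) (hf0 : ∀ y ∈ D, 0 ≤ f y)
    (hf : ConvexOn ℝ D f) (k : ℝ) (hk : 0 ≤ k) :
    ConvexOn ℝ Set.univ (paschEnv D f k) := by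
  refine ⟨convex_univ, ?_⟩
  intro x _ y _ a b ha hb hab
  refine le_of_forall_pos_le_add fun ε hε => ?_
  obtain ⟨x', hx', hx2⟩ := pasch_lt D hD f k x _ (lt_add_of_pos_right _ hε)
  obtain ⟨y', hy', hy2⟩ := pasch_lt D hD f k y _ (lt_add_of_pos_right _ hε)
  have h1 := pasch_le D f hf0 k hk (a • x + b • y) _ (hf.1 hx' hy' ha hb hab)
  have h2 := hf.2 hx' hy' ha hb hab
  have h3 : ‖a • x + b • y - (a • x' + b • y')‖ ≤ a * ‖x - x'‖ + b * ‖y - y'‖ := by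
    have : a • x + b • y - (a • x' + b • y') = a • (x - x') + b • (y - y') := by module
    rw [this]
    refine (norm_add_le _ _).trans ?_
    rw [norm_smul, norm_smul, Real.norm_of_nonneg ha, Real.norm_of_nonneg hb]
  have h4 := mul_le_mul_of_nonneg_left h3 hk
  simp only [smul_eq_mul] at h2 ⊢
  have h5 := mul_le_mul_of_nonneg_left hx2.le ha
  have h6 := mul_le_mul_of_nonneg_left hy2.le hb
  have h7 : a * ε + b * ε = ε := by rw [← add_mul, hab, one_mul]
  nlinarith

end helpers

/-- A convex, lower semicontinuous, proper, essentially smooth integrand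
`F : E → ℝ ∪ {+∞}` with `F(ξ) ≥ c‖ξ‖` (`c > 0`) admits a sequence of smooth, convex,
globally Lipschitz approximations `F_j : E → ℝ` such that: (i) `F_j ≤ F_{j+1}` and
`sup_j F_j = F` pointwise; (ii) `F_j(ξ) ≥ c‖ξ‖ − 1`; (iii) the recession functions
`F_j^∞` increase pointwise to `F^∞`; (iv) `F_j → F` locally uniformly on
`C = int dom F`; and (v) `∇F_j → ∇F` locally uniformly on `C`. -/
theorem approximation_of_essentially_smooth_convex_integrand
    {E : Type*} [NormedAddCommGroup E] [InnerProductSpace ℝ E] [FiniteDimensional ℝ E]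
    (F : E → EReal)
    (hne_bot : ∀ ξ : E, F ξ ≠ ⊥)
    (hconv : ∀ x y : E, ∀ a b : ℝ, 0 ≤ a → 0 ≤ b → a + b = 1 →
      F (a • x + b • y) ≤ (a : EReal) * F x + (b : EReal) * F y)
    (hlsc : LowerSemicontinuous F)
    (c : ℝ) (hc : 0 < c)
    (hlb : ∀ ξ : E, ((c * ‖ξ‖ : ℝ) : EReal) ≤ F ξ)
    (C : Set E) (hC : C = interior {ξ : E | F ξ < ⊤}) (hCne : C.Nonempty)
    (F' : E → E)
    (hF'grad : ∀ ξ ∈ C, HasGradientAt (fun x => (F x).toReal) (F' ξ) ξ)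
    (hF'cont : ContinuousOn F' C)
    (hblowup : ∀ x ∈ frontier {ξ : E | F ξ < ⊤}, ∀ xi : ℕ → E, (∀ i, xi i ∈ C) →
      Tendsto xi atTop (𝓝 x) → Tendsto (fun i => ‖F' (xi i)‖) atTop atTop) :
    ∃ (G : ℕ → E → ℝ) (G' : ℕ → E → E),
      (∀ j, ContDiff ℝ (⊤ : ℕ∞) (G j)) ∧
      (∀ j, ConvexOn ℝ Set.univ (G j)) ∧
      (∀ j, ∃ L : ℝ≥0, LipschitzWith L (G j)) ∧
      -- (i) monotonicity and pointwise convergence to F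
      (∀ j ξ, G j ξ ≤ G (j + 1) ξ) ∧
      (∀ ξ : E, (⨆ j : ℕ, ((G j ξ : ℝ) : EReal)) = F ξ) ∧
      -- (ii) uniform lower bound
      (∀ j ξ, c * ‖ξ‖ - 1 ≤ G j ξ) ∧
      -- (iii) recession functions increase pointwise to that of F
      (∀ j ξ,
        (⨆ t : {t : ℝ // 0 < t}, ((G j ((t : ℝ) • ξ) / (t : ℝ) : ℝ) : EReal)) ≤
          ⨆ t : {t : ℝ // 0 < t}, ((G (j + 1) ((t : ℝ) • ξ) / (t : ℝ) : ℝ) : EReal)) ∧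
      (∀ ξ : E,
        (⨆ j : ℕ, ⨆ t : {t : ℝ // 0 < t},
            ((G j ((t : ℝ) • ξ) / (t : ℝ) : ℝ) : EReal)) =
          ⨆ t : {t : ℝ // 0 < t}, (((t : ℝ)⁻¹ : ℝ) : EReal) * F ((t : ℝ) • ξ)) ∧
      -- (iv) locally uniform convergence on C
      TendstoLocallyUniformlyOn (fun j ξ => G j ξ) (fun ξ => (F ξ).toReal) atTop C ∧
      -- (v) gradients and their locally uniform convergence on C
      (∀ j ξ, HasGradientAt (G j) (G' j ξ) ξ) ∧
      TendstoLocallyUniformlyOn (fun j ξ => G' j ξ) F' atTop C := by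
  set D : Set E := {ξ : E | F ξ < ⊤} with hDdef
  set f : E → ℝ := fun x => (F x).toReal with hfdef
  have hCD : C ⊆ D := hC ▸ interior_subset
  have hCo : IsOpen C := hC ▸ isOpen_interior
  have hDne : D.Nonempty := hCne.mono hCD
  have hcoe : ∀ y ∈ D, ((f y : ℝ) : EReal) = F y := fun y hy =>
    EReal.coe_toReal (ne_of_lt hy) (hne_bot y)
  have hflb : ∀ y ∈ D, c * ‖y‖ ≤ f y := by
    intro y hy
    have := hlb y
    rw [← hcoe y hy] at this
    exact_mod_cast this
  have hf0 : ∀ y ∈ D, 0 ≤ f y := fun y hy => le_trans (by positivity) (hflb y hy)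
  have hfconv : ConvexOn ℝ D f := by
    have key : ∀ x ∈ D, ∀ y ∈ D, ∀ a b : ℝ, 0 ≤ a → 0 ≤ b → a + b = 1 →
        F (a • x + b • y) ≤ ((a * f x + b * f y : ℝ) : EReal) := by
      intro x hx y hy a b ha hb hab
      have := hconv x y a b ha hb hab
      rw [← hcoe x hx, ← hcoe y hy] at this
      exact_mod_cast this
    have hDc : Convex ℝ D := by
      intro x hx y hy a b ha hb hab
      exact (key x hx y hy a b ha hb hab).trans_lt (EReal.coe_lt_top _)
    refine ⟨hDc, ?_⟩
    intro x hx y hy a b ha hb hab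
    have := key x hx y hy a b ha hb hab
    rw [← hcoe _ (hDc hx hy ha hb hab)] at this
    exact_mod_cast this
  -- the Pasch-Hausdorff envelopes
  let k : ℕ → ℝ≥0 := fun j => ⟨c + j, by positivity⟩
  have hk : ∀ j, (k j : ℝ) = c + j := fun j => rfl
  let P : ℕ → E → ℝ := fun j => paschEnv D f (k j)
  have hPf : ∀ j, ∀ x ∈ D, P j x ≤ f x := by
    intro j x hx
    simpa using pasch_le D f hf0 (k j) (k j).2 x x hx
  have hPmono : ∀ j x, P j x ≤ P (j + 1) x := by
    intro j x
    refine le_pasch D hDne f _ x _ fun y hy => ?_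
    refine (pasch_le D f hf0 (k j) (k j).2 x y hy).trans ?_
    have : (k j : ℝ) ≤ k (j + 1) := by rw [hk, hk]; push_cast; linarith
    gcongr
  have hPlb : ∀ j x, c * ‖x‖ ≤ P j x := by
    intro j x
    refine le_pasch D hDne f _ x _ fun y hy => ?_
    have h1 := hflb y hy
    have h2 : ‖x‖ ≤ ‖y‖ + ‖x - y‖ := by
      have := norm_add_le y (x - y)
      rwa [add_sub_cancel] at this
    have h3 : c * ‖x - y‖ ≤ k j * ‖x - y‖ := by
      rw [hk]; gcongr; linarith [(Nat.cast_nonneg j : (0 : ℝ) ≤ j)]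
    nlinarith
  have hPlarge : ∀ x : E, ∀ M : ℝ, (M : EReal) < F x → ∃ j0, ∀ j ≥ j0, M ≤ P j x := by
    intro x M hM
    obtain ⟨r, hr, hrb⟩ := Metric.eventually_nhds_iff_ball.1 (hlsc x M hM)
    obtain ⟨j0, hj0⟩ := exists_nat_ge (M / r)
    refine ⟨j0, fun j hj => le_pasch D hDne f _ x _ fun y hy => ?_⟩
    by_cases hyr : y ∈ Metric.ball x r
    · have h1 : (M : EReal) < F y := hrb y hyr
      rw [← hcoe y hy] at h1
      have h2 : M < f y := by exact_mod_cast h1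
      have : 0 ≤ (k j : ℝ) * ‖x - y‖ := by positivity
      linarith
    · have h1 : r ≤ ‖x - y‖ := by
        rw [Metric.mem_ball, not_lt, dist_comm, dist_eq_norm] at hyr
        exact hyr
      have h2 : (j0 : ℝ) ≤ k j := by
        rw [hk]
        have : (j0 : ℝ) ≤ j := by exact_mod_cast hj
        linarith
      have h3 : M ≤ j0 * r := (div_le_iff₀ hr).1 hj0
      have h4 : (j0 : ℝ) * r ≤ k j * ‖x - y‖ := by gcongr
      linarith [hf0 y hy]
  -- smoothing
  let η : ℕ → ℝ := fun j => (1 / 2 : ℝ) ^ j / 8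
  have hη : ∀ j, 0 < η j := fun j => by positivity
  have hηs : ∀ j, η (j + 1) = η j / 2 := fun j => by simp only [η, pow_succ]; ring
  have hη1 : ∀ j, η j ≤ 1 / 8 := fun j => by
    have : (1 / 2 : ℝ) ^ j ≤ 1 := pow_le_one₀ (by norm_num) (by norm_num)
    simp only [η]; linarith
  choose H hHs hHc hHl hHa using fun j => exists_smooth_convex_approx (P j)
    (pasch_convex D hDne f hf0 hfconv (k j) (k j).2) (k j) (pasch_lip D hDne f hf0 (k j))
    (η j) (hη j)
  let G : ℕ → E → ℝ := fun j x => H j x - 4 * η j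
  have hGP : ∀ j x, G j x ≤ P j x := by
    intro j x
    have := (abs_le.1 (hHa j x)).2
    simp only [G]; linarith [hη j]
  have hPG : ∀ j x, P j x - 5 * η j ≤ G j x := by
    intro j x
    have := (abs_le.1 (hHa j x)).1
    simp only [G]; linarith [hη j]
  have hGs : ∀ j, ContDiff ℝ (⊤ : ℕ∞) (G j) := fun j => (hHs j).sub contDiff_const
  have hGc : ∀ j, ConvexOn ℝ Set.univ (G j) := fun j => by
    have h0 : G j = H j + fun _ => -(4 * η j) := by
      ext x; simp [G, sub_eq_add_neg]
    rw [h0]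
    exact (hHc j).add_const (-(4 * η j))
  have hGl : ∀ j, LipschitzWith (k j) (G j) := fun j => by
    refine LipschitzWith.of_le_add_mul _ fun x y => ?_
    have := (hHl j).le_add_mul x y
    simp only [G]; linarith
  have hGm : ∀ j x, G j x ≤ G (j + 1) x := by
    intro j x
    have h1 := (abs_le.1 (hHa j x)).2
    have h2 := (abs_le.1 (hHa (j + 1) x)).1
    have h3 := hPmono j x
    have h4 := hηs j
    simp only [G]; linarith [hη j]
  have hηt : Tendsto η atTop (𝓝 0) := by
    have := (tendsto_pow_atTop_nhds_zero_of_lt_one (r := (1 / 2 : ℝ)) (by norm_num)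
      (by norm_num)).div_const 8
    simpa [η] using this
  have hGf : ∀ j, ∀ x ∈ D, G j x ≤ f x := fun j x hx => (hGP j x).trans (hPf j x hx)
  have hsup : ∀ ξ : E, (⨆ j : ℕ, ((G j ξ : ℝ) : EReal)) = F ξ := by
    intro x
    refine le_antisymm (iSup_le fun j => ?_) (le_of_forall_lt fun a ha => ?_)
    · by_cases hx : x ∈ D
      · rw [← hcoe x hx]
        exact_mod_cast hGf j x hx
      · have : F x = ⊤ := by simpa [hDdef] using hx
        rw [this]; exact le_top
    · obtain ⟨M, hM1, hM2⟩ := EReal.lt_iff_exists_real_btwn.1 ha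
      obtain ⟨N, hN1, hN2⟩ := EReal.lt_iff_exists_real_btwn.1 hM2
      have hMN : M < N := by exact_mod_cast hN1
      obtain ⟨j0, hj0⟩ := hPlarge x N hN2
      have hev : ∀ᶠ j in atTop, η j < (N - M) / 5 :=
        hηt.eventually (gt_mem_nhds (by linarith))
      obtain ⟨j, hj1, hj2⟩ := (hev.and (eventually_ge_atTop j0)).exists
      have : M ≤ G j x := by linarith [hPG j x, hj0 j hj2]
      refine hM1.trans_le (le_trans ?_ (le_iSup (fun j => ((G j x : ℝ) : EReal)) j))
      exact_mod_cast this
  have hGt : ∀ x ∈ C, Tendsto (fun j => G j x) atTop (𝓝 (f x)) := by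
    intro x hx
    have h1 : Monotone (fun j => ((G j x : ℝ) : EReal)) :=
      monotone_nat_of_le_succ fun j => by exact_mod_cast hGm j x
    have h2 := tendsto_atTop_iSup h1
    rw [hsup x, ← hcoe x (hCD hx)] at h2
    exact EReal.tendsto_coe.1 h2
  have hunif : TendstoLocallyUniformlyOn G f atTop C := by
    refine Monotone.tendstoLocallyUniformlyOn_of_forall_tendsto
      (fun j => (hGl j).continuous.continuousOn) (fun x _ => monotone_nat_of_le_succ fun j => hGm j x)
      ?_ hGt
    exact fun x hx => (hF'grad x hx).differentiableAt.continuousAt.continuousWithinAt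
  have hGg : ∀ j ξ, HasGradientAt (G j) (gradient (G j) ξ) ξ := fun j ξ =>
    ((hGs j).differentiable (by simp) ξ).hasGradientAt
  refine ⟨G, fun j => gradient (G j), hGs, hGc, fun j => ⟨k j, hGl j⟩, hGm, hsup, ?_, ?_, ?_, hunif,
    hGg, ?_⟩
  · intro j ξ
    linarith [hPG j ξ, hPlb j ξ, hη1 j]
  · intro j ξ
    refine iSup_mono fun t => ?_
    have := div_le_div_of_nonneg_right (hGm j ((t : ℝ) • ξ)) t.2.le
    exact_mod_cast this
  · intro ξ
    rw [iSup_comm]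
    congr 1
    ext t
    have ht : (0 : ℝ) < (t : ℝ)⁻¹ := inv_pos.2 t.2
    have ht' : (0 : EReal) < (((t : ℝ)⁻¹ : ℝ) : EReal) := by exact_mod_cast ht
    rw [← hsup ((t : ℝ) • ξ)]
    refine eq_of_forall_ge_iff fun b => ?_
    rw [mul_comm, ← EReal.le_div_iff_mul_le ht' (EReal.coe_ne_top _), iSup_le_iff, iSup_le_iff]
    refine forall_congr' fun j => ?_
    rw [EReal.le_div_iff_mul_le ht' (EReal.coe_ne_top _), div_eq_mul_inv, EReal.coe_mul]
  · exact gradient_tendsto G (fun j => gradient (G j)) f F' C hCo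
      (hfconv.subset hCD (hC ▸ hfconv.1.interior)) hGc hGg hF'grad hF'cont hunif
end
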